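/- Let (T_i)_{i∈I} be any family of G-trees. Then there exists a countable subset J ⊆ I with the following property: if T is a G-tree such that every edge stabilizer of T is elliptic in T_i for every i ∈ I, and T dominates T_j for every j ∈ J, then T dominates T_i for every i ∈ I. -/

import Mathlib

universe u v

/-- A `G`-tree: a nonempty simple graph which is a tree (connected and acyclic),
with a minimal action of `G` by graph automorphisms without inversions. -/
structure GTree (G : Type u) [Group G] : Type (u + 1) where
  V : Type u
  graph : SimpleGraph V
  nonempty : Nonempty V
  connected : graph.Connected
  acyclic : graph.IsAcyclic
  act : G → V → V
  act_one : ∀ w, act 1 w = w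
  act_mul : ∀ g h w, act (g * h) w = act g (act h w)
  act_adj : ∀ g a b, graph.Adj a b → graph.Adj (act g a) (act g b)
  noInversion : ∀ g a b, graph.Adj a b → ¬(act g a = b ∧ act g b = a)
  minimal : ∀ S : Set V, S.Nonempty → (∀ g, ∀ w ∈ S, act g w ∈ S) →
    (graph.induce S).Connected → S = Set.univ

namespace GTree

variable {G : Type u} [Group G]

/-- The stabilizer of a vertex. -/
def vertexStab (T : GTree G) (w : T.V) : Subgroup G where
  carrier := {g | T.act g w = w}
  one_mem' := T.act_one w
  mul_mem' := by
    intro a b ha hb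
    simp only [Set.mem_setOf_eq] at *
    rw [T.act_mul, hb, ha]
  inv_mem' := by
    intro a ha
    simp only [Set.mem_setOf_eq] at *
    calc T.act a⁻¹ w = T.act a⁻¹ (T.act a w) := by rw [ha]
    _ = T.act (a⁻¹ * a) w := (T.act_mul _ _ _).symm
    _ = w := by rw [inv_mul_cancel, T.act_one]

/-- The stabilizer of an edge `{u,v}`: elements fixing both endpoints. -/
def edgeStab (T : GTree G) (a b : T.V) : Subgroup G :=
  T.vertexStab a ⊓ T.vertexStab b

/-- A subgroup is elliptic in `T` if it fixes a vertex. -/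
def EllipticSubgroup (T : GTree G) (H : Subgroup G) : Prop :=
  ∃ w : T.V, ∀ h ∈ H, T.act h w = w

/-- An element is elliptic in `T` if it fixes a vertex (otherwise it is hyperbolic). -/
def EllipticElt (T : GTree G) (g : G) : Prop :=
  ∃ w : T.V, T.act g w = w

/-- `T₁` dominates `T₂`: every subgroup elliptic in `T₁` is elliptic in `T₂`. -/
def Dominates (T₁ T₂ : GTree G) : Prop :=
  ∀ H : Subgroup G, T₁.EllipticSubgroup H → T₂.EllipticSubgroup H

/-- `T` is an `𝒜`-tree: all its edge stabilizers belong to `𝒜`. -/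
def IsATree (T : GTree G) (𝒜 : Set (Subgroup G)) : Prop :=
  ∀ a b : T.V, T.graph.Adj a b → T.edgeStab a b ∈ 𝒜

/-- A subgroup is universally elliptic if it is elliptic in every `𝒜`-tree. -/
def UnivEllipticSubgroup (𝒜 : Set (Subgroup G)) (H : Subgroup G) : Prop :=
  ∀ T : GTree G, T.IsATree 𝒜 → T.EllipticSubgroup H

/-- An `𝒜`-tree is universally elliptic if all its edge stabilizers are universally elliptic. -/
def UnivEllipticTree (T : GTree G) (𝒜 : Set (Subgroup G)) : Prop :=
  ∀ a b : T.V, T.graph.Adj a b → UnivEllipticSubgroup 𝒜 (T.edgeStab a b)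

/-- A JSJ tree of `G` over `𝒜`: a universally elliptic `𝒜`-tree dominating every
universally elliptic `𝒜`-tree. -/
def IsJSJ (T : GTree G) (𝒜 : Set (Subgroup G)) : Prop :=
  T.IsATree 𝒜 ∧ T.UnivEllipticTree 𝒜 ∧
    ∀ T' : GTree G, T'.IsATree 𝒜 → T'.UnivEllipticTree 𝒜 → T.Dominates T'

/-- A collapse map `T → T'`: a `G`-equivariant surjection on vertices sending adjacent
vertices to adjacent or equal vertices, with connected point preimages. -/
def IsCollapseMap (T T' : GTree G) (f : T.V → T'.V) : Prop :=
  (∀ g w, f (T.act g w) = T'.act g (f w)) ∧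
    Function.Surjective f ∧
    (∀ a b : T.V, T.graph.Adj a b → f a = f b ∨ T'.graph.Adj (f a) (f b)) ∧
    ∀ w : T'.V, (T.graph.induce (f ⁻¹' {w})).Connected

end GTree

/-- `𝒜` is closed under conjugation and under passing to subgroups. -/
def ClosedFamily {G : Type u} [Group G] (𝒜 : Set (Subgroup G)) : Prop :=
  (∀ H ∈ 𝒜, ∀ g : G, Subgroup.map (MulAut.conj g).toMonoidHom H ∈ 𝒜) ∧
    ∀ H ∈ 𝒜, ∀ K : Subgroup G, K ≤ H → K ∈ 𝒜

/-- `G` is finitely presented: it admits a presentation with finitely many generators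
and finitely many relations. -/
def FinitelyPresentedGroup (G : Type u) [Group G] : Prop :=
  ∃ (n : ℕ) (rels : Set (FreeGroup (Fin n))),
    rels.Finite ∧ Nonempty (PresentedGroup rels ≃* G)

/-- `T` is an `(𝒜,ℋ)`-tree: an `𝒜`-tree in which every subgroup in `ℋ` is elliptic. -/
def RelATree {G : Type u} [Group G] (𝒜 ℋ : Set (Subgroup G)) (T : GTree G) : Prop :=
  T.IsATree 𝒜 ∧ ∀ H ∈ ℋ, T.EllipticSubgroup H

/-- A subgroup is universally elliptic relative to `ℋ` if it is elliptic in every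
`(𝒜,ℋ)`-tree. -/
def RelUnivEllipticSubgroup {G : Type u} [Group G] (𝒜 ℋ : Set (Subgroup G))
    (K : Subgroup G) : Prop :=
  ∀ T : GTree G, RelATree 𝒜 ℋ T → T.EllipticSubgroup K

/-- An `(𝒜,ℋ)`-tree is universally elliptic if all its edge stabilizers are universally
elliptic relative to `ℋ`. -/
def RelUnivEllipticTree {G : Type u} [Group G] (𝒜 ℋ : Set (Subgroup G))
    (T : GTree G) : Prop :=
  ∀ a b : T.V, T.graph.Adj a b → RelUnivEllipticSubgroup 𝒜 ℋ (T.edgeStab a b)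

/-- A JSJ tree of `G` over `𝒜` relative to `ℋ`. -/
def IsRelJSJ {G : Type u} [Group G] (𝒜 ℋ : Set (Subgroup G)) (T : GTree G) : Prop :=
  RelATree 𝒜 ℋ T ∧ RelUnivEllipticTree 𝒜 ℋ T ∧
    ∀ T' : GTree G, RelATree 𝒜 ℋ T' → RelUnivEllipticTree 𝒜 ℋ T' → T.Dominates T'

/-- The family of groups `F, H₁, …, H_p` whose free product is used to define relative
finite presentability. -/
def relFam {G : Type u} [Group G] {p : ℕ} (H : Fin p → Subgroup G) (n : ℕ) :
    Option (Fin p) → Type u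
  | none => FreeGroup (ULift.{u} (Fin n))
  | some j => H j

instance relFamGroup {G : Type u} [Group G] {p : ℕ} (H : Fin p → Subgroup G) (n : ℕ) :
    (i : Option (Fin p)) → Group (relFam H n i)
  | none => inferInstanceAs (Group (FreeGroup _))
  | some j => inferInstanceAs (Group (H j))

/-- `G` is finitely presented relative to `H₁, …, H_p`: there is a surjection from
`F ∗ H₁ ∗ ⋯ ∗ H_p` (with `F` a finitely generated free group) onto `G` restricting to
the inclusion on each `Hᵢ`, whose kernel is the normal closure of a finite subset. -/
def RelFinitelyPresented {G : Type u} [Group G] {p : ℕ} (H : Fin p → Subgroup G) : Prop :=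
  ∃ (n : ℕ) (φ : Monoid.CoprodI (relFam H n) →* G),
    Function.Surjective φ ∧
    (∀ (j : Fin p) (h : H j), φ (Monoid.CoprodI.of (M := relFam H n) (i := some j) h) = (h : G)) ∧
    ∃ s : Set (Monoid.CoprodI (relFam H n)), s.Finite ∧
      MonoidHom.ker φ = Subgroup.normalClosure s

/-- `S` has a single orbit of edges. -/
def OneEdgeOrbit {G : Type u} [Group G] (S : GTree G) : Prop :=
  ∀ e₁ ∈ S.graph.edgeSet, ∀ e₂ ∈ S.graph.edgeSet, ∃ g : G, Sym2.map (S.act g) e₁ = e₂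

/-- `G` splits over `K`: there is a nontrivial `G`-tree with a single orbit of edges
having `K` as an edge stabilizer. -/
def SplitsOver {G : Type u} [Group G] (K : Subgroup G) : Prop :=
  ∃ S : GTree G, Nontrivial S.V ∧ OneEdgeOrbit S ∧
    ∃ x y : S.V, S.graph.Adj x y ∧ S.edgeStab x y = K

/-- A subgroup is slender if all its subgroups are finitely generated. -/
def SlenderSubgroup {G : Type u} [Group G] (H : Subgroup G) : Prop :=
  ∀ K : Subgroup G, K ≤ H → K.FG

/-- A subgroup is abelian. -/
def AbelianSubgroup {G : Type u} [Group G] (H : Subgroup G) : Prop :=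
  ∀ a ∈ H, ∀ b ∈ H, a * b = b * a

/-- `H` is malnormal in `G`: `gHg⁻¹ ∩ H ≠ {1}` implies `g ∈ H`. -/
def Malnormal {G : Type u} [Group G] (H : Subgroup G) : Prop :=
  ∀ g : G, (∃ x ∈ H, x ≠ 1 ∧ g * x * g⁻¹ ∈ H) → g ∈ H

/-- `G` is CSA: the centralizer of every nontrivial element is abelian and malnormal. -/
def IsCSA (G : Type u) [Group G] : Prop :=
  ∀ g : G, g ≠ 1 →
    AbelianSubgroup (Subgroup.centralizer {g}) ∧ Malnormal (Subgroup.centralizer {g})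

namespace SimpleGraph

variable {V : Type*} {Γ : SimpleGraph V}

/-- In a tree, the neighbour of `x` which is closer to `z` is unique. -/
lemma IsTree.eq_of_adj_of_dist_lt (hΓ : Γ.IsTree) {x y y' z : V} (hy : Γ.Adj x y)
    (hy' : Γ.Adj x y') (h : Γ.dist y z < Γ.dist x z) (h' : Γ.dist y' z < Γ.dist x z) :
    y = y' := by
  have key : ∀ {y}, Γ.Adj x y → Γ.dist y z < Γ.dist x z →
      ∃ p : Γ.Walk x z, p.IsPath ∧ p.snd = y := by
    intro y hy h
    obtain ⟨p, hp⟩ := hΓ.connected.exists_walk_length_eq_dist y z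
    refine ⟨.cons hy p, Walk.isPath_of_length_eq_dist _ ?_, by simp⟩
    have := dist_le (Walk.cons hy p)
    simp only [Walk.length_cons] at this ⊢
    lia
  obtain ⟨p, hp, rfl⟩ := key hy h
  obtain ⟨q, hq, rfl⟩ := key hy' h'
  rw [(hΓ.existsUnique_path x z).unique hp hq]

lemma Connected.exists_adj_dist_eq (hΓ : Γ.Connected) {p q : V} {n : ℕ}
    (h : Γ.dist p q = n + 1) : ∃ p', Γ.Adj p p' ∧ Γ.dist p' q = n := by
  obtain ⟨w, hw⟩ := hΓ.exists_walk_length_eq_dist p q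
  cases w with
  | nil => simp at h
  | @cons _ p' _ hadj w =>
    refine ⟨p', hadj, ?_⟩
    have h₁ := dist_le w
    have h₂ := hΓ.dist_triangle (u := p) (v := p') (w := q)
    rw [dist_eq_one_iff_adj.mpr hadj] at h₂
    simp only [Walk.length_cons] at hw
    lia

/-- In a tree, if the first step of the geodesic from `p` to `q` leads away from `z`, then the
geodesic from `q` to `z` passes through `p`. -/
lemma IsTree.dist_eq_add_of_dist_lt (hΓ : Γ.IsTree) {z : V} {n : ℕ} :
    ∀ {p p' q : V}, Γ.Adj p p' → Γ.dist p' q = n → Γ.dist p q = n + 1 →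
      Γ.dist p z < Γ.dist p' z → Γ.dist q z = n + 1 + Γ.dist p z := by
  induction n with
  | zero =>
    intro p p' q hadj h₁ h₂ h
    obtain rfl := hΓ.connected.dist_eq_zero_iff.mp h₁
    have := hΓ.dist_eq_dist_add_one_of_adj z hadj
    simp only [dist_comm (u := z)] at this
    lia
  | succ n ih =>
    intro p p' q hadj h₁ h₂ h
    obtain ⟨p'', hadj', h₃⟩ := hΓ.connected.exists_adj_dist_eq h₁
    have d₁ := hΓ.dist_eq_dist_add_one_of_adj z hadj
    have d₂ := hΓ.dist_eq_dist_add_one_of_adj z hadj'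
    simp only [dist_comm (u := z)] at d₁ d₂
    rcases lt_or_ge (Γ.dist p' z) (Γ.dist p'' z) with h₄ | h₄
    · have := ih hadj' h₃ h₁ h₄
      lia
    · have := hΓ.eq_of_adj_of_dist_lt hadj.symm hadj' h (by lia)
      subst this
      lia

/-- Let `W` be a graph with a map `f` to an acyclic graph which preserves adjacency and is
injective on oriented edges. Then `f` is injective on connected components. -/
lemma IsAcyclic.eq_of_reachable_of_edge_injective (hΓ : Γ.IsAcyclic) {V' : Type*}
    {W : SimpleGraph V'} (f : W →g Γ)
    (hf : ∀ ⦃a b a' b'⦄, W.Adj a b → W.Adj a' b' → f a = f a' → f b = f b' → a = a')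
    {a b : V'} (hab : W.Reachable a b) (h : f a = f b) : a = b := by
  classical
  obtain ⟨p, hp⟩ := hab.exists_isPath
  have htrail : (p.map f).IsTrail := by
    rw [Walk.isTrail_def, Walk.edges_map]
    refine hp.isTrail.edges_nodup.map_on ?_
    intro e he e' he' hee
    have h₁ := p.edges_subset_edgeSet he
    have h₂ := p.edges_subset_edgeSet he'
    clear he he'
    induction e with | _ x y
    induction e' with | _ x' y'
    rw [mem_edgeSet] at h₁ h₂
    rw [Sym2.map_mk, Sym2.map_mk, Sym2.eq_iff] at hee
    rcases hee with ⟨hx, hy⟩ | ⟨hx, hy⟩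
    · rw [hf h₁ h₂ hx hy, hf h₁.symm h₂.symm hy hx]
    · rw [hf h₁ h₂.symm hx hy, hf h₁.symm h₂ hy hx, Sym2.eq_swap]
  have hpath := (hΓ.isPath_iff_isTrail _).mpr htrail
  have hlen : p.length = 0 := by
    rw [← Walk.length_map f]
    generalize p.map f = q at hpath
    clear htrail
    revert q
    rw [h]
    intro q hq
    rw [Walk.isPath_iff_nil] at hq
    exact Walk.length_eq_zero_iff.mpr hq
  exact Walk.eq_of_length_eq_zero hlen

section Action

variable {G : Type*} [Group G] [MulAction G V]

lemma Reachable.dist_smul_le (hadj : ∀ (g : G) a b, Γ.Adj a b → Γ.Adj (g • a) (g • b)) (g : G)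
    {a b : V} (h : Γ.Reachable a b) : Γ.dist (g • a) (g • b) ≤ Γ.dist a b := by
  obtain ⟨w, hw⟩ := h.exists_walk_length_eq_dist
  let φ : Γ →g Γ := ⟨(g • ·), hadj g _ _⟩
  rw [← hw, ← Walk.length_map φ]
  exact dist_le (w.map φ)

lemma Connected.dist_smul (hΓ : Γ.Connected)
    (hadj : ∀ (g : G) a b, Γ.Adj a b → Γ.Adj (g • a) (g • b)) (g : G) (a b : V) :
    Γ.dist (g • a) (g • b) = Γ.dist a b := by
  refine le_antisymm ((hΓ a b).dist_smul_le hadj g) ?_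
  simpa using (hΓ (g • a) (g • b)).dist_smul_le hadj g⁻¹

/-- Serre's lemma: if two groups of automorphisms of a tree each fix a vertex, and every element
of the group they generate fixes a vertex, then they have a common fixed vertex. -/
lemma IsTree.exists_fixed_sup (hΓ : Γ.IsTree)
    (hadj : ∀ (g : G) a b, Γ.Adj a b → Γ.Adj (g • a) (g • b)) {A B : Subgroup G}
    (hA : ∃ w : V, A ≤ MulAction.stabilizer G w) (hB : ∃ w : V, B ≤ MulAction.stabilizer G w)
    (hAB : ∀ g ∈ A ⊔ B, ∃ w : V, g • w = w) :
    ∃ w : V, A ⊔ B ≤ MulAction.stabilizer G w := by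
  classical
  have hex : ∃ n, ∃ p q : V, A ≤ MulAction.stabilizer G p ∧ B ≤ MulAction.stabilizer G q ∧
      Γ.dist p q = n := by
    obtain ⟨p, hp⟩ := hA
    obtain ⟨q, hq⟩ := hB
    exact ⟨_, p, q, hp, hq, rfl⟩
  have hmin := fun m => Nat.find_min hex (m := m)
  obtain ⟨p, q, hp, hq, hpq⟩ := Nat.find_spec hex
  generalize Nat.find hex = n at hmin hpq
  cases n with
  | zero =>
    obtain rfl := hΓ.connected.dist_eq_zero_iff.mp hpq
    exact ⟨p, sup_le hp hq⟩
  | succ n =>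
    exfalso
    obtain ⟨p', hpp', hp'q⟩ := hΓ.connected.exists_adj_dist_eq hpq
    obtain ⟨q', hqq', hq'p⟩ := hΓ.connected.exists_adj_dist_eq (dist_comm.trans hpq)
    obtain ⟨a, haA, hap'⟩ : ∃ a ∈ A, a • p' ≠ p' := by
      by_contra! hcon
      exact hmin n (by lia) ⟨p', q, hcon, hq, hp'q⟩
    obtain ⟨b, hbB, hbq'⟩ : ∃ b ∈ B, b • q' ≠ q' := by
      by_contra! hcon
      exact hmin n (by lia) ⟨p, q', hp, hcon, dist_comm.trans hq'p⟩
    have hap : a • p = p := hp haA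
    have hbq : b • q = q := hq hbB
    obtain ⟨z, hz⟩ := hAB (a * b) (mul_mem (Subgroup.mem_sup_left haA)
      (Subgroup.mem_sup_right hbB))
    rw [mul_smul] at hz
    have d := hΓ.connected.dist_smul hadj
    have hpz : Γ.dist p (b • z) = Γ.dist p z := by
      rw [← d a p (b • z), hz, hap]
    have hqz : Γ.dist q (b • z) = Γ.dist q z := by
      rw [← d b q z, hbq]
    have tri : ∀ {u v w : V}, Γ.dist u w ≤ Γ.dist u v + Γ.dist v w :=
      hΓ.connected.dist_triangle
    have e₁ := hΓ.dist_eq_dist_add_one_of_adj z hpp'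
    have e₂ := hΓ.dist_eq_dist_add_one_of_adj (b • z) hpp'
    simp only [dist_comm (u := z), dist_comm (u := b • z)] at e₁ e₂
    have hqp : Γ.dist q' p = Γ.dist p q' := dist_comm
    have hqp' : Γ.dist q p' = Γ.dist p' q := dist_comm
    have far : ∀ t, Γ.dist p t < Γ.dist p' t → Γ.dist q t = n + 1 + Γ.dist p t := fun t ht =>
      hΓ.dist_eq_add_of_dist_lt hpp' hp'q hpq ht
    by_cases hside : Γ.dist p z < Γ.dist p' z
    · have h₁ := far z hside
      have h₂ := tri (u := q') (v := p) (w := z)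
      have h₃ := tri (u := q') (v := p) (w := b • z)
      refine hbq' (hΓ.eq_of_adj_of_dist_lt (x := q) (z := b • z) ?_ hqq' ?_ ?_)
      · simpa only [hbq] using hadj b _ _ hqq'
      · rw [d, hqz]; lia
      · lia
    · have h₁ : Γ.dist p' (b • z) < Γ.dist p (b • z) := by
        by_contra hcon
        have h₂ := far (b • z) (by lia)
        have h₃ := tri (u := q) (v := p') (w := z)
        lia
      refine hap' (hΓ.eq_of_adj_of_dist_lt (x := p) (z := z) ?_ hpp' ?_ ?_)
      · simpa only [hap] using hadj a _ _ hpp'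
      · rw [← hz, d, hz]; lia
      · lia

open scoped Pointwise in
/-- Vertex stabilizers of an action of a finitely generated group on a tree are finitely generated
relative to the stabilizers of finitely many incident edges. -/
lemma IsTree.exists_finite_relative_generators (hΓ : Γ.IsTree)
    (hadj : ∀ (g : G) a b, Γ.Adj a b → Γ.Adj (g • a) (g • b)) (hfg : Group.FG G) (v : V) :
    ∃ (E : Set V) (F : Set G), E.Finite ∧ F.Finite ∧ (∀ n ∈ E, Γ.Adj v n) ∧
      F ⊆ MulAction.stabilizer G v ∧
      ∀ H ≤ MulAction.stabilizer G v,
        (∀ n ∈ E, MulAction.stabilizer G v ⊓ MulAction.stabilizer G n ≤ H) → F ⊆ H →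
        MulAction.stabilizer G v ≤ H := by
  obtain ⟨S, hS⟩ := Group.fg_def.mp hfg
  have hτ : ∀ x : V, ∃ t : G, (∃ g : G, g • v = x) → t • v = x := by
    intro x
    by_cases h : ∃ g : G, g • v = x
    · exact ⟨h.choose, fun _ => h.choose_spec⟩
    · exact ⟨1, fun h' => absurd h' h⟩
  choose τ hτ using hτ
  have hφ : ∀ n n' : V, ∃ f ∈ MulAction.stabilizer G v,
      (∃ g ∈ MulAction.stabilizer G v, g • n = n') → f • n = n' := by
    intro n n'
    by_cases h : ∃ g ∈ MulAction.stabilizer G v, g • n = n'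
    · exact ⟨h.choose, h.choose_spec.1, fun _ => h.choose_spec.2⟩
    · exact ⟨1, one_mem _, fun h' => absurd h' h⟩
  choose φ hφv hφ using hφ
  have walk : ∀ s : G, Γ.Walk v (s • v) := fun s => (hΓ.connected v (s • v)).some
  let K : Set V := ⋃ s ∈ S, {x | x ∈ (walk s).support}
  have hK : K.Finite := S.finite_toSet.biUnion fun s _ => (walk s).support.finite_toSet
  let P : Set V := {n | Γ.Adj v n} ∩ Set.image2 (fun x y => (τ x)⁻¹ • y) K K
  have hP : P.Finite := (hK.image2 _ hK).subset Set.inter_subset_right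
  refine ⟨P, Set.image2 φ P P ∪ {τ v} ∪ (fun s => (τ (s • v))⁻¹ * s) '' (S : Set G), hP,
    ((hP.image2 _ hP).union (Set.finite_singleton _)).union (S.finite_toSet.image _),
    fun n hn => hn.1, ?_, ?_⟩
  · rintro _ ((⟨n, -, n', -, rfl⟩ | rfl) | ⟨s, -, rfl⟩)
    · exact hφv n n'
    · exact hτ v ⟨1, one_smul _ _⟩
    · change ((τ (s • v))⁻¹ * s) • v = v
      rw [mul_smul, inv_smul_eq_iff]
      exact (hτ (s • v) ⟨s, rfl⟩).symm
  intro H hHv hE hF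
  have hmem : ∀ n ∈ P, ∀ n' ∈ P, ∀ g ∈ MulAction.stabilizer G v, g • n = n' → g ∈ H := by
    intro n hn n' hn' g hg hgn
    have h₁ : φ n n' ∈ H := hF (Or.inl (Or.inl ⟨n, hn, n', hn', rfl⟩))
    have h₂ : (φ n n')⁻¹ * g ∈ H := by
      refine hE n hn (Subgroup.mem_inf.mpr ⟨mul_mem (inv_mem (hφv n n')) hg, ?_⟩)
      change ((φ n n')⁻¹ * g) • n = n
      rw [mul_smul, inv_smul_eq_iff, hgn, hφ n n' ⟨g, hg, hgn⟩]
    simpa using mul_mem h₁ h₂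
  let L : V → V → Set G := fun x y => {g | g • v = x ∧ ∃ h ∈ H, ∃ r ∈ P, (g * h) • r = y}
  let l : V → Set G := fun x => {g | g • v = x ∧ (τ x)⁻¹ * g ∈ H}
  have hLl : ∀ x ∈ K, ∀ y ∈ K, Γ.Adj x y → l x = L x y := by
    intro x hx y hy hxy
    ext g
    refine and_congr_right fun hg => ?_
    have hτx : τ x • v = x := hτ x ⟨g, hg⟩
    have hn : (τ x)⁻¹ • y ∈ P := by
      refine ⟨?_, x, hx, y, hy, rfl⟩
      have := hadj (τ x)⁻¹ _ _ hxy
      rwa [inv_smul_eq_iff.mpr hτx.symm] at this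
    constructor
    · intro h
      refine ⟨((τ x)⁻¹ * g)⁻¹, inv_mem h, _, hn, ?_⟩
      simp [smul_smul]
    · rintro ⟨h, hh, r, hr, rfl⟩
      have h₁ : (τ x)⁻¹ * g ∈ MulAction.stabilizer G v := by
        change ((τ x)⁻¹ * g) • v = v
        rw [mul_smul, hg, inv_smul_eq_iff, hτx]
      have h₂ := hmem r hr _ hn _ (mul_mem h₁ (hHv hh)) (by simp [smul_smul, mul_assoc])
      simpa using mul_mem h₂ (inv_mem hh)
  have hLsmul : ∀ (k : G) x y, L (k • x) (k • y) = k • L x y := by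
    intro k x y
    ext g
    simp only [L, Set.mem_smul_set_iff_inv_smul_mem, Set.mem_ofPred_eq, smul_eq_mul,
      mul_smul, inv_smul_eq_iff]
  -- the tree obtained by unfolding `Γ` at the orbit of `v`, replacing `v` by the cosets of `H`
  let W : SimpleGraph (V × Set G) :=
    { Adj := fun a b => Γ.Adj a.1 b.1 ∧ a.2 = L a.1 b.1 ∧ b.2 = L b.1 a.1
      symm := ⟨fun a b h => ⟨h.1.symm, h.2.2, h.2.1⟩⟩
      loopless := ⟨fun a h => h.1.ne rfl⟩ }
  have hWsmul : ∀ (k : G) a b, W.Adj a b → W.Adj (k • a) (k • b) := by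
    rintro k a b ⟨h₁, h₂, h₃⟩
    refine ⟨hadj k _ _ h₁, ?_, ?_⟩
    · simp only [Prod.smul_snd, Prod.smul_fst, hLsmul, ← h₂]
    · simp only [Prod.smul_snd, Prod.smul_fst, hLsmul, ← h₃]
  have hlift : ∀ {a b : V} (w : Γ.Walk a b), (∀ x ∈ w.support, x ∈ K) →
      W.Reachable (a, l a) (b, l b) := by
    intro a b w
    induction w with
    | nil => exact fun _ => .rfl
    | @cons a c b hac w ih =>
      intro hw
      have ha : a ∈ K := hw a (by simp)
      have hc : c ∈ K := hw c (by simp)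
      refine Reachable.trans (Adj.reachable ?_) (ih fun x hx => hw x (by simp [hx]))
      exact ⟨hac, hLl a ha c hc hac, hLl c hc a ha hac.symm⟩
  let o : V × Set G := (v, H)
  have hgen : ∀ s ∈ S, W.Reachable o (s • o) := by
    intro s hs
    have h₁ : l v = H := by
      have hτv : τ v ∈ H := hF (Or.inl (Or.inr rfl))
      ext g
      refine ⟨fun h => ?_, fun h => ⟨hHv h, mul_mem (inv_mem hτv) h⟩⟩
      simpa using mul_mem hτv h.2
    have h₂ : l (s • v) = s • (H : Set G) := by
      have hτs : (τ (s • v))⁻¹ * s ∈ H := hF (Or.inr ⟨s, hs, rfl⟩)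
      ext g
      rw [Set.mem_smul_set_iff_inv_smul_mem]
      constructor
      · intro h
        have := mul_mem (inv_mem hτs) h.2
        simpa [mul_assoc] using this
      · intro h
        refine ⟨?_, ?_⟩
        · have : (s⁻¹ * g) • v = v := hHv h
          rwa [mul_smul, inv_smul_eq_iff] at this
        · have := mul_mem hτs h
          simpa [mul_assoc] using this
    have h₃ := hlift (walk s) fun x hx => Set.mem_biUnion hs hx
    rwa [h₁, h₂] at h₃
  have hW : ∀ (k : G) {a b}, W.Reachable a b → W.Reachable (k • a) (k • b) := fun k _ _ h =>
    h.map ⟨(k • ·), hWsmul k _ _⟩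
  have hreach : ∀ g : G, W.Reachable o (g • o) := by
    intro g
    have hg : g ∈ Subgroup.closure (S : Set G) := hS ▸ Subgroup.mem_top g
    induction hg using Subgroup.closure_induction with
    | mem s hs => exact hgen s hs
    | one => rw [one_smul]
    | mul x y _ _ hx hy => exact hx.trans (mul_smul x y o ▸ hW x hy)
    | inv x _ hx => simpa using (hW x⁻¹ hx).symm
  intro g hg
  have ho : o = g • o := by
    refine hΓ.isAcyclic.eq_of_reachable_of_edge_injective
      (f := (⟨Prod.fst, fun h => h.1⟩ : W →g Γ)) ?_ (hreach g) hg.symm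
    rintro ⟨a, A⟩ ⟨b, B⟩ ⟨a', A'⟩ ⟨b', B'⟩ h h' (rfl : a = a') (rfl : b = b')
    exact Prod.ext rfl (h.2.1.trans h'.2.1.symm)
  have hH : (H : Set G) = g • (H : Set G) := congrArg Prod.snd ho
  rw [← SetLike.mem_coe, hH, Set.mem_smul_set_iff_inv_smul_mem]
  simp

end Action

end SimpleGraph

/-- A finitely generated group is countable. -/
lemma Group.FG.countable {G : Type*} [Group G] (hfg : Group.FG G) : Countable G := by
  obtain ⟨S, hS⟩ := Group.fg_def.mp hfg
  rw [FreeGroup.closure_eq_range, MonoidHom.range_eq_top] at hS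
  have : Countable (FreeGroup (S : Set G)) := Quot.mk_surjective.countable
  exact hS.countable

namespace GTree

variable {G : Type u} [Group G] (T : GTree G)

instance : MulAction G T.V where
  smul := T.act
  one_smul := T.act_one
  mul_smul := T.act_mul

lemma isTree : T.graph.IsTree := ⟨T.connected, T.acyclic⟩

variable {T}

lemma EllipticSubgroup.mono {H K : Subgroup G} (h : T.EllipticSubgroup K) (hHK : H ≤ K) :
    T.EllipticSubgroup H :=
  h.imp fun _ hw g hg => hw g (hHK hg)

lemma ellipticSubgroup_zpowers_iff {g : G} :
    T.EllipticSubgroup (Subgroup.zpowers g) ↔ T.EllipticElt g :=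
  exists_congr fun w => (Subgroup.zpowers_le (H := T.vertexStab w) :)

/-- If the edge stabilizers of `S` and all elements elliptic in `S` are elliptic in `T`, then `S`
dominates `T`. -/
lemma dominates_of_ellipticElt (hfg : Group.FG G) {S T : GTree G}
    (hedge : ∀ a b : S.V, S.graph.Adj a b → T.EllipticSubgroup (S.edgeStab a b))
    (helt : ∀ g, S.EllipticElt g → T.EllipticElt g) : S.Dominates T := by
  rintro H ⟨v, hv⟩
  refine EllipticSubgroup.mono (K := S.vertexStab v) ?_ hv
  obtain ⟨E, F, hE, hF, hEadj, hFv, hgen⟩ :=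
    S.isTree.exists_finite_relative_generators S.act_adj hfg v
  let good : Subgroup G → Prop := fun K => K ≤ S.vertexStab v ∧ T.EllipticSubgroup K
  have hbot : good ⊥ := by
    refine ⟨bot_le, T.nonempty.some, fun h hh => ?_⟩
    rw [Subgroup.mem_bot.mp hh, T.act_one]
  have hsup : ∀ A, good A → ∀ B, good B → good (A ⊔ B) := fun A hA B hB =>
    ⟨sup_le hA.1 hB.1, T.isTree.exists_fixed_sup T.act_adj hA.2 hB.2 fun g hg =>
      helt g ⟨v, sup_le hA.1 hB.1 hg⟩⟩
  have h₁ : good (hE.toFinset.sup fun n => S.edgeStab v n) :=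
    Finset.sup_induction hbot hsup fun n hn =>
      ⟨inf_le_left, hedge v n (hEadj n (hE.mem_toFinset.mp hn))⟩
  have h₂ : good (hF.toFinset.sup Subgroup.zpowers) :=
    Finset.sup_induction hbot hsup fun f hf => by
      have hfv := hFv (hF.mem_toFinset.mp hf)
      exact ⟨Subgroup.zpowers_le.mpr hfv, ellipticSubgroup_zpowers_iff.mpr (helt f ⟨v, hfv⟩)⟩
  have h := hsup _ h₁ _ h₂
  refine h.2.mono (hgen _ h.1 (fun n hn => le_sup_of_le_left ?_) fun f hf => ?_)
  · exact Finset.le_sup (f := fun n => S.edgeStab v n) (hE.mem_toFinset.mpr hn)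
  · exact Subgroup.mem_sup_right (Finset.le_sup (f := Subgroup.zpowers) (hF.mem_toFinset.mpr hf)
      (Subgroup.mem_zpowers f))

end GTree

/-- a countable subfamily suffices to test domination of a family of trees. -/
theorem countable_domination_test {G : Type u} [Group G] (hfg : Group.FG G)
    {ι : Type v} (T : ι → GTree G) :
    ∃ J : Set ι, J.Countable ∧
      ∀ S : GTree G,
        (∀ (i : ι) (a b : S.V), S.graph.Adj a b → (T i).EllipticSubgroup (S.edgeStab a b)) →
        (∀ j ∈ J, S.Dominates (T j)) →
        ∀ i : ι, S.Dominates (T i) := by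
  have := hfg.countable
  refine ⟨⋃ g : G, {i | ∃ h : ∃ i, ¬(T i).EllipticElt g, i = h.choose}, ?_, ?_⟩
  · refine Set.countable_iUnion fun g => Set.Subsingleton.countable ?_
    rintro _ ⟨h, rfl⟩ _ ⟨-, rfl⟩
    rfl
  · intro S hedge hdom i
    refine GTree.dominates_of_ellipticElt hfg (hedge i) fun g hg => ?_
    by_contra hcon
    have h : ∃ i, ¬(T i).EllipticElt g := ⟨i, hcon⟩
    exact h.choose_spec (GTree.ellipticSubgroup_zpowers_iff.mp
      (hdom _ (Set.mem_iUnion.mpr ⟨g, h, rfl⟩) _ (GTree.ellipticSubgroup_zpowers_iff.mpr hg)))
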